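/- Let M be a bounded complex of A-modules such that each term M_i is locally finite and each cohomology module H^i(M) is finite-dimensional over k, and let N = (N_i) be a subcomplex of M with every N_i finite-dimensional over k. Then M admits a subcomplex F = (F_i) with every F_i finite-dimensional over k, with N_i ⊆ F_i for all i, and such that the inclusion F ⊆ M is a quasi-isomorphism. -/

import Mathlib

/-- Given a complex `(M i, δ i)` of `A`-modules (the differential `δ i : M i → M (i+1)`)
and a family of submodules `F i ⊆ M i`, this is the natural map
`(F (i+1) ∩ ker δ_{i+1}) / δ_i(F i) → ker δ_{i+1} / range δ_i` induced by the inclusion;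
the target is the cohomology of `M` at position `i + 1`. -/
noncomputable def inducedCohMap {A : Type*} [Ring A]
    {M : ℤ → Type*} [∀ i, AddCommGroup (M i)] [∀ i, Module A (M i)]
    (δ : ∀ i : ℤ, M i →ₗ[A] M (i + 1))
    (F : ∀ i : ℤ, Submodule A (M i)) (i : ℤ) :
    (↥(F (i + 1) ⊓ LinearMap.ker (δ (i + 1))) ⧸
        Submodule.comap (F (i + 1) ⊓ LinearMap.ker (δ (i + 1))).subtype
          (Submodule.map (δ i) (F i))) →ₗ[A]
      (↥(LinearMap.ker (δ (i + 1))) ⧸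
        Submodule.comap (LinearMap.ker (δ (i + 1))).subtype (LinearMap.range (δ i))) :=
  Submodule.liftQ _
    ((Submodule.mkQ _).comp (Submodule.inclusion inf_le_right))
    (by
      intro x hx
      obtain ⟨w, -, hwx⟩ := Submodule.mem_map.mp (Submodule.mem_comap.mp hx)
      rw [LinearMap.mem_ker, LinearMap.comp_apply, Submodule.mkQ_apply,
        Submodule.Quotient.mk_eq_zero, Submodule.mem_comap]
      exact ⟨w, hwx⟩)

/-- A finitely generated submodule of the range of `f` is the image of a finitely generated
submodule. -/
theorem Submodule.FG.exists_fg_map_eq {A M M' : Type*} [Ring A] [AddCommGroup M] [Module A M]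
    [AddCommGroup M'] [Module A M'] (f : M →ₗ[A] M') {Q : Submodule A M'} (hQ : Q.FG)
    (hle : Q ≤ LinearMap.range f) : ∃ P : Submodule A M, P.FG ∧ P.map f = Q := by
  classical
  obtain ⟨S, rfl⟩ := hQ
  have hS : (S : Set M') ⊆ f '' Set.univ := fun y hy => by
    obtain ⟨x, rfl⟩ := hle (Submodule.subset_span hy)
    exact ⟨x, trivial, rfl⟩
  obtain ⟨T, -, hT⟩ := Finset.subset_set_image_iff.mp hS
  refine ⟨Submodule.span A T, ⟨T, rfl⟩, ?_⟩
  rw [Submodule.map_span, ← hT, Finset.coe_image]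

/-- A submodule contained in a submodule of finite `k`-dimension is finitely generated. -/
theorem Submodule.fg_of_le_of_finiteDimensional (k : Type*) {A M : Type*} [Field k] [Ring A]
    [Algebra k A] [AddCommGroup M] [Module k M] [Module A M] [IsScalarTower k A M]
    {P Q : Submodule A M} [FiniteDimensional k Q] (h : P ≤ Q) : P.FG := by
  have : FiniteDimensional k P :=
    FiniteDimensional.of_injective ((Submodule.inclusion h).restrictScalars k)
      (Submodule.inclusion_injective h)
  exact Module.Finite.iff_fg.mp (Module.Finite.of_restrictScalars_finite k A P)

/-- If the cohomology `ker g / range f` has finite `k`-dimension, then it is represented by a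
finitely generated module of cocycles. -/
theorem exists_fg_le_ker_le_sup_range (k : Type*) {A L M M' : Type*} [Field k] [Ring A]
    [Algebra k A] [AddCommGroup L] [Module A L] [AddCommGroup M] [Module k M] [Module A M]
    [IsScalarTower k A M] [AddCommGroup M'] [Module A M'] (f : L →ₗ[A] M) (g : M →ₗ[A] M')
    [FiniteDimensional k (LinearMap.ker g ⧸
      Submodule.comap (LinearMap.ker g).subtype (LinearMap.range f))] :
    ∃ Z : Submodule A M, Z.FG ∧ Z ≤ LinearMap.ker g ∧
      LinearMap.ker g ≤ Z ⊔ LinearMap.range f := by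
  have hfin : Module.Finite A (LinearMap.ker g ⧸
      Submodule.comap (LinearMap.ker g).subtype (LinearMap.range f)) :=
    Module.Finite.of_restrictScalars_finite k A _
  obtain ⟨P, hP, hPtop⟩ := hfin.fg_top.exists_fg_map_eq
    (Submodule.mkQ (Submodule.comap (LinearMap.ker g).subtype (LinearMap.range f)))
    (Submodule.range_mkQ _).ge
  refine ⟨P.map (LinearMap.ker g).subtype, hP.map _, Submodule.map_subtype_le _ _, ?_⟩
  intro x hx
  obtain ⟨z, hz, hzx⟩ := hPtop.ge (Submodule.mem_top (x := Submodule.Quotient.mk ⟨x, hx⟩))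
  have hxz := (Submodule.Quotient.eq _).mp hzx.symm
  rw [← add_sub_cancel (z : M) x]
  exact Submodule.add_mem_sup ⟨z, hz, rfl⟩ hxz

/-- A descending recursion along `ℤ` whose steps are trivial in large degrees has a solution. -/
theorem exists_forall_eq_step_of_subsingleton {X : ℤ → Type*} [∀ i, Nonempty (X i)] (b : ℕ)
    (hX : ∀ i : ℤ, (b : ℤ) < i → Subsingleton (X i)) (step : ∀ i, X (i + 1) → X i) :
    ∃ F : ∀ i, X i, ∀ i, F i = step i (F (i + 1)) := by
  let S : ℕ → ∀ i, X i := fun n =>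
    Nat.rec (fun i => Classical.arbitrary (X i)) (fun _ G i => step i (G (i + 1))) n
  have hsucc : ∀ (n : ℕ) (i : ℤ), (b : ℤ) < i + n → S (n + 1) i = S n i := by
    intro n
    induction n with
    | zero =>
      intro i hi
      have := hX i (by simpa using hi)
      exact Subsingleton.elim _ _
    | succ n ih =>
      intro i hi
      exact congrArg (step i) (ih (i + 1) (by push_cast at hi; linarith))
  have hstable : ∀ (i : ℤ) (n m : ℕ), (b : ℤ) < i + n → n ≤ m → S m i = S n i := by
    intro i n m hn hnm
    induction m, hnm using Nat.le_induction with
    | base => rfl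
    | succ m hm ih => exact (hsucc m i (by omega)).trans ih
  refine ⟨fun i => S (b + 1 - i).toNat i, fun i => ?_⟩
  calc S (b + 1 - i).toNat i = S ((b + 1 - (i + 1)).toNat + 1) i :=
        (hstable i (b + 1 - i).toNat ((b + 1 - (i + 1)).toNat + 1) (by omega) (by omega)).symm
    _ = step i (S (b + 1 - (i + 1)).toNat (i + 1)) := rfl

/-- A criterion for the map induced on cohomology by a subcomplex to be bijective. -/
theorem inducedCohMap_bijective {A : Type*} [Ring A]
    {M : ℤ → Type*} [∀ i, AddCommGroup (M i)] [∀ i, Module A (M i)]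
    (δ : ∀ i : ℤ, M i →ₗ[A] M (i + 1))
    (F : ∀ i : ℤ, Submodule A (M i)) (i : ℤ)
    (hinj : F (i + 1) ⊓ LinearMap.range (δ i) ≤ (F i).map (δ i))
    (hsurj : LinearMap.ker (δ (i + 1)) ≤
      F (i + 1) ⊓ LinearMap.ker (δ (i + 1)) ⊔ LinearMap.range (δ i)) :
    Function.Bijective (inducedCohMap δ F i) := by
  constructor
  · rw [injective_iff_map_eq_zero]
    intro q hq
    induction q using Submodule.Quotient.induction_on with
    | H x =>
      have hx : (x : M (i + 1)) ∈ LinearMap.range (δ i) :=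
        (Submodule.Quotient.mk_eq_zero
          (Submodule.comap (LinearMap.ker (δ (i + 1))).subtype (LinearMap.range (δ i)))
          (x := Submodule.inclusion inf_le_right x)).mp hq
      exact (Submodule.Quotient.mk_eq_zero _).mpr (hinj ⟨x.2.1, hx⟩)
  · intro q
    induction q using Submodule.Quotient.induction_on with
    | H x =>
      obtain ⟨z, hz, w, hw, hzw⟩ := Submodule.mem_sup.mp (hsurj x.2)
      refine ⟨Submodule.Quotient.mk ⟨z, hz⟩, (Submodule.Quotient.eq _).mpr ?_⟩
      change z - (x : M (i + 1)) ∈ LinearMap.range (δ i)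
      rw [← hzw, sub_add_cancel_left]
      exact neg_mem hw

/-- Let `M` be a bounded complex of `A`-modules (over a `k`-algebra `A`) whose terms are
locally finite `A`-modules and whose cohomology modules are finite-dimensional over `k`,
and let `N` be a subcomplex of `M` all of whose terms are finite-dimensional over `k`.
Then `M` admits a subcomplex `F` containing `N`, with all terms finite-dimensional over
`k`, such that the inclusion `F ⊆ M` is a quasi-isomorphism. -/
theorem exists_finiteDimensional_quasiIso_subcomplex_containing
    {k A : Type*} [Field k] [Ring A] [Algebra k A]
    (M : ℤ → Type*) [∀ i, AddCommGroup (M i)] [∀ i, Module k (M i)]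
    [∀ i, Module A (M i)] [∀ i, IsScalarTower k A (M i)]
    (δ : ∀ i : ℤ, M i →ₗ[A] M (i + 1))
    (hδδ : ∀ (i : ℤ) (x : M i), δ (i + 1) (δ i x) = 0)
    (hbdd : ∃ Nb : ℕ, ∀ i : ℤ, (Nb : ℤ) < |i| → ∀ x : M i, x = 0)
    (hlocfin : ∀ (i : ℤ) (p : Submodule A (M i)), p.FG → FiniteDimensional k ↥p)
    (hcohfin : ∀ i : ℤ, FiniteDimensional k
      (↥(LinearMap.ker (δ (i + 1))) ⧸
        Submodule.comap (LinearMap.ker (δ (i + 1))).subtype (LinearMap.range (δ i))))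
    (N : ∀ i : ℤ, Submodule A (M i))
    (hNsub : ∀ i : ℤ, ∀ x ∈ N i, δ i x ∈ N (i + 1))
    (hNfin : ∀ i : ℤ, FiniteDimensional k ↥(N i)) :
    ∃ F : ∀ i : ℤ, Submodule A (M i),
      (∀ i : ℤ, ∀ x ∈ F i, δ i x ∈ F (i + 1)) ∧
      (∀ i : ℤ, FiniteDimensional k ↥(F i)) ∧
      (∀ i : ℤ, N i ≤ F i) ∧
      (∀ i : ℤ, Function.Bijective (inducedCohMap δ F i)) := by
  obtain ⟨b, hb⟩ := hbdd
  have hcocycles : ∀ j : ℤ, ∃ Z : Submodule A (M j), Z.FG ∧ Z ≤ LinearMap.ker (δ j) ∧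
      ∀ (i : ℤ) (h : i + 1 = j), ∀ x ∈ LinearMap.ker (δ j),
        x ∈ Z ⊔ (h ▸ LinearMap.range (δ i) : Submodule A (M j)) := by
    intro j
    obtain ⟨i, rfl⟩ : ∃ i, j = i + 1 := ⟨j - 1, by ring⟩
    have := hcohfin i
    obtain ⟨Z, hZ, hZker, hkerZ⟩ := exists_fg_le_ker_le_sup_range k (δ i) (δ (i + 1))
    refine ⟨Z, hZ, hZker, fun i' h x hx => ?_⟩
    obtain rfl : i' = i := by omega
    exact hkerZ hx
  choose Z hZfg hZker hkerZ using hcocycles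
  have hNfg : ∀ i, (N i).FG := fun i => by
    have := hNfin i
    exact Submodule.fg_of_le_of_finiteDimensional k le_rfl
  let X : ℤ → Type _ := fun i => {G : Submodule A (M i) // G.FG ∧ N i ≤ G}
  have hstep : ∀ (i : ℤ) (G : X (i + 1)), ∃ F : X i,
      F.1.map (δ i) = G.1 ⊓ LinearMap.range (δ i) ∧ Z i ≤ F.1 := by
    rintro i ⟨G, hG, hNG⟩
    have := hlocfin _ G hG
    obtain ⟨P, hP, hPmap⟩ := Submodule.FG.exists_fg_map_eq (δ i)
      (Submodule.fg_of_le_of_finiteDimensional k (P := G ⊓ LinearMap.range (δ i)) inf_le_left)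
      inf_le_right
    refine ⟨⟨P ⊔ (N i ⊔ Z i), hP.sup ((hNfg i).sup (hZfg i)),
      le_sup_left.trans le_sup_right⟩, ?_, le_sup_right.trans le_sup_right⟩
    have hN : (N i).map (δ i) ≤ G ⊓ LinearMap.range (δ i) :=
      le_inf (Submodule.map_le_iff_le_comap.mpr fun x hx => hNG (hNsub i x hx))
        LinearMap.map_le_range
    rw [Submodule.map_sup, Submodule.map_sup, hPmap, LinearMap.le_ker_iff_map.mp (hZker i),
      sup_bot_eq, sup_eq_left.mpr hN]
  choose step hstepmap hstepZ using hstep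
  have hne : ∀ i, Nonempty (X i) := fun i => ⟨⟨N i, hNfg i, le_rfl⟩⟩
  have hsub : ∀ i : ℤ, (b : ℤ) < i → Subsingleton (X i) := by
    intro i hi
    have hM : Subsingleton (M i) :=
      subsingleton_of_forall_eq 0 (hb i (hi.trans_le (le_abs_self i)))
    exact inferInstanceAs (Subsingleton {G : Submodule A (M i) // G.FG ∧ N i ≤ G})
  obtain ⟨F, hF⟩ := exists_forall_eq_step_of_subsingleton b hsub step
  have hFmap : ∀ i, (F i).1.map (δ i) = (F (i + 1)).1 ⊓ LinearMap.range (δ i) := fun i => by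
    rw [hF i, hstepmap]
  have hZF : ∀ i, Z i ≤ (F i).1 := fun i => by
    rw [hF i]
    exact hstepZ _ _
  refine ⟨fun i => (F i).1, fun i x hx => ?_, fun i => hlocfin i _ (F i).2.1,
    fun i => (F i).2.2, fun i => inducedCohMap_bijective δ _ i (hFmap i).ge fun x hx => ?_⟩
  · exact ((hFmap i).le (Submodule.mem_map_of_mem hx)).1
  · exact sup_le_sup_right (le_inf (hZF _) (hZker _)) _ (hkerZ (i + 1) i rfl x hx)
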